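/- (Firey's L_p Brunn–Minkowski inequality for volume, derived in Example 3.1 with j = n.) Let n ≥ 1, p ∈ (1,∞), K, L ∈ 𝒦ⁿₒ and α ∈ (0,1). Then V_n((1-α)·_p K +_p α·_p L)^{p/n} ≥ (1-α)V_n(K)^{p/n} + α V_n(L)^{p/n}, with equality if and only if K and L are dilates, where V_n denotes n-dimensional Lebesgue measure. -/

import Mathlib

open scoped Pointwise RealInnerProductSpace

/-- A convex body in `ℝⁿ`: a compact convex set with nonempty interior. -/
def IsConvexBody {n : ℕ} (K : Set (EuclideanSpace ℝ (Fin n))) : Prop :=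
  IsCompact K ∧ Convex ℝ K ∧ (interior K).Nonempty

/-- A convex body containing the origin in its interior. -/
def IsConvexBodyO {n : ℕ} (K : Set (EuclideanSpace ℝ (Fin n))) : Prop :=
  IsCompact K ∧ Convex ℝ K ∧ (0 : EuclideanSpace ℝ (Fin n)) ∈ interior K

/-- The support function of a set: `h_K(u) = sup { ⟪x, u⟫ : x ∈ K }`. -/
noncomputable def supp {n : ℕ} (K : Set (EuclideanSpace ℝ (Fin n)))
    (u : EuclideanSpace ℝ (Fin n)) : ℝ :=
  sSup ((fun x => ⟪x, u⟫) '' K)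

open MeasureTheory

lemma bm1_compact {A B C : Set ℝ} (hA : IsCompact A) (hB : IsCompact B) (hAn : A.Nonempty)
    (hBn : B.Nonempty) (h : ∀ x ∈ A, ∀ y ∈ B, x + y ∈ C) :
    volume A + volume B ≤ volume C := by
  obtain ⟨a, haA, ha⟩ := hA.exists_isGreatest hAn
  obtain ⟨b, hbB, hb⟩ := hB.exists_isLeast hBn
  have h1 : volume ((fun x => b + x) '' A) = volume A := by
    simp [Set.image_add_left, measure_preimage_add]
  have h2 : volume ((fun x => a + x) '' B) = volume B := by
    simp [Set.image_add_left, measure_preimage_add]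
  rw [← h1, ← h2, ← measure_union₀]
  · apply measure_mono
    rintro _ (⟨x, hx, rfl⟩ | ⟨y, hy, rfl⟩)
    · have := h x hx b hbB
      rwa [add_comm] at this
    · exact h a haA y hy
  · exact ((hB.image (by fun_prop)).measurableSet).nullMeasurableSet
  · refine measure_mono_null (t := {a + b}) ?_ (by simp)
    rintro _ ⟨⟨x, hx, rfl⟩, ⟨y, hy, hxy⟩⟩
    have := ha hx
    have := hb hy
    simp only at hxy
    simp only [Set.mem_singleton_iff]
    linarith

lemma bm1 {A B C : Set ℝ} (hA : MeasurableSet A) (hB : MeasurableSet B) (hAn : A.Nonempty)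
    (hBn : B.Nonempty) (h : ∀ x ∈ A, ∀ y ∈ B, x + y ∈ C) :
    volume A + volume B ≤ volume C := by
  obtain ⟨a0, ha0⟩ := hAn
  obtain ⟨b0, hb0⟩ := hBn
  rw [hA.measure_eq_iSup_isCompact, hB.measure_eq_iSup_isCompact]
  simp only [iSup_and']
  refine ENNReal.biSup_add_biSup_le' ⟨∅, by simp⟩ ⟨∅, by simp⟩ ?_
  rintro K ⟨hKA, hK⟩ J ⟨hJB, hJ⟩
  calc volume K + volume J ≤ volume (insert a0 K) + volume (insert b0 J) := by
        gcongr <;> exact Set.subset_insert _ _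
    _ ≤ volume C := by
        refine bm1_compact (hK.insert _) (hJ.insert _) (Set.insert_nonempty _ _)
          (Set.insert_nonempty _ _) ?_
        intro x hx y hy
        exact h x (Set.insert_subset ha0 hKA hx) y (Set.insert_subset hb0 hJB hy)

lemma ennreal_amgm {l : ℝ} (h0 : 0 < l) (h1 : l < 1) (a b : ENNReal) :
    a ^ (1 - l) * b ^ l ≤ ENNReal.ofReal (1 - l) * a + ENNReal.ofReal l * b := by
  by_cases ha : a = ⊤
  · subst ha
    rw [ENNReal.mul_top (by simpa using h1)]; simp
  by_cases hb : b = ⊤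
  · subst hb
    rw [ENNReal.mul_top (by simpa using h0)]; simp
  lift a to NNReal using ha
  lift b to NNReal using hb
  have := NNReal.geom_mean_le_arith_mean2_weighted (1 - l).toNNReal l.toNNReal a b (by
    rw [← Real.toNNReal_add (by linarith) h0.le]; simp)
  rw [Real.coe_toNNReal _ (by linarith), Real.coe_toNNReal _ h0.le] at this
  rw [← ENNReal.coe_rpow_of_nonneg _ (by linarith), ← ENNReal.coe_rpow_of_nonneg _ h0.le]
  unfold ENNReal.ofReal
  exact_mod_cast this

lemma pl1_norm {l : ℝ} (h0 : 0 < l) (h1 : l < 1) {f g h : ℝ → ℝ} (hf : Measurable f)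
    (hg : Measurable g) (hh : Measurable h) (f0 : ∀ x, 0 ≤ f x) (g0 : ∀ x, 0 ≤ g x)
    (hh0 : ∀ x, 0 ≤ h x) (f1 : ∀ x, f x ≤ 1) (g1 : ∀ x, g x ≤ 1)
    (fs : ∀ t < 1, ∃ x, t < f x) (gs : ∀ t < 1, ∃ x, t < g x)
    (hyp : ∀ x y, f x ^ (1 - l) * g y ^ l ≤ h ((1 - l) * x + l * y)) :
    ENNReal.ofReal (1 - l) * (∫⁻ x, ENNReal.ofReal (f x)) +
      ENNReal.ofReal l * (∫⁻ x, ENNReal.ofReal (g x)) ≤ ∫⁻ x, ENNReal.ofReal (h x) := by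
  rw [lintegral_eq_lintegral_meas_lt _ (.of_forall f0) hf.aemeasurable,
    lintegral_eq_lintegral_meas_lt _ (.of_forall g0) hg.aemeasurable,
    lintegral_eq_lintegral_meas_lt _ (.of_forall hh0) hh.aemeasurable,
    ← lintegral_const_mul' _ _ (by simp), ← lintegral_const_mul' _ _ (by simp),
    ← lintegral_add_left']
  · refine setLIntegral_mono' measurableSet_Ioi ?_
    intro t (ht : 0 < t)
    by_cases ht1 : t < 1
    · have e1 : ENNReal.ofReal (1 - l) * volume {a | t < f a} =
          volume ((1 - l) • {a | t < f a}) := by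
        rw [Measure.addHaar_smul]; simp [abs_of_pos (sub_pos.2 h1)]
      have e2 : ENNReal.ofReal l * volume {a | t < g a} =
          volume (l • {a | t < g a}) := by
        rw [Measure.addHaar_smul]; simp [abs_of_pos h0]
      rw [e1, e2]
      apply bm1
      · exact (measurableSet_lt measurable_const hf).const_smul₀ _
      · exact (measurableSet_lt measurable_const hg).const_smul₀ _
      · obtain ⟨x, hx⟩ := fs t ht1
        exact ⟨_, Set.smul_mem_smul_set hx⟩
      · obtain ⟨x, hx⟩ := gs t ht1
        exact ⟨_, Set.smul_mem_smul_set hx⟩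
      · rintro _ ⟨x, hx, rfl⟩ _ ⟨y, hy, rfl⟩
        refine lt_of_lt_of_le ?_ (hyp x y)
        have : t = t ^ (1 - l) * t ^ l := by
          rw [← Real.rpow_add ht]; simp
        rw [this]
        exact mul_lt_mul'' (Real.rpow_lt_rpow ht.le hx (by linarith))
          (Real.rpow_lt_rpow ht.le hy h0) (by positivity) (by positivity)
    · have e1 : {a | t < f a} = ∅ := by
        ext x; simp; linarith [f1 x]
      have e2 : {a | t < g a} = ∅ := by
        ext x; simp; linarith [g1 x]
      simp [e1, e2]
  · refine AEMeasurable.const_mul (Antitone.measurable ?_).aemeasurable _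
    intro s t hst
    exact measure_mono fun x hx => lt_of_le_of_lt hst hx

lemma pl1 {l : ℝ} (h0 : 0 < l) (h1 : l < 1) {f g h : ℝ → ℝ} (hf : Measurable f)
    (hg : Measurable g) (hh : Measurable h) (f0 : ∀ x, 0 ≤ f x) (g0 : ∀ x, 0 ≤ g x)
    (hh0 : ∀ x, 0 ≤ h x) (f1 : BddAbove (Set.range f)) (g1 : BddAbove (Set.range g))
    (hyp : ∀ x y, f x ^ (1 - l) * g y ^ l ≤ h ((1 - l) * x + l * y)) :
    (∫⁻ x, ENNReal.ofReal (f x)) ^ (1 - l) * (∫⁻ x, ENNReal.ofReal (g x)) ^ l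
      ≤ ∫⁻ x, ENNReal.ofReal (h x) := by
  have hl1 : 0 < 1 - l := by linarith
  by_cases hfz : ∀ x, f x = 0
  · simp [hfz, ENNReal.zero_rpow_of_pos hl1]
  by_cases hgz : ∀ x, g x = 0
  · simp [hgz, ENNReal.zero_rpow_of_pos h0]
  push Not at hfz hgz
  obtain ⟨x0, hx0⟩ := hfz
  obtain ⟨y0, hy0⟩ := hgz
  set a := sSup (Set.range f) with ha
  set b := sSup (Set.range g) with hb
  have lea : ∀ x, f x ≤ a := fun x => le_csSup f1 ⟨x, rfl⟩
  have leb : ∀ x, g x ≤ b := fun x => le_csSup g1 ⟨x, rfl⟩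
  have apos : 0 < a := lt_of_lt_of_le (lt_of_le_of_ne (f0 x0) hx0.symm) (lea x0)
  have bpos : 0 < b := lt_of_lt_of_le (lt_of_le_of_ne (g0 y0) hy0.symm) (leb y0)
  set c := a ^ (1 - l) * b ^ l with hc
  have cpos : 0 < c := by positivity
  have key := pl1_norm h0 h1 (f := fun x => f x / a) (g := fun x => g x / b)
    (h := fun x => h x / c) (hf.div_const _) (hg.div_const _) (hh.div_const _)
    (fun x => div_nonneg (f0 x) apos.le) (fun x => div_nonneg (g0 x) bpos.le)
    (fun x => div_nonneg (hh0 x) cpos.le)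
    (fun x => (div_le_one apos).2 (lea x)) (fun x => (div_le_one bpos).2 (leb x))
    (fun t ht => by
      obtain ⟨_, ⟨x, rfl⟩, hx⟩ := exists_lt_of_lt_csSup (Set.range_nonempty f)
        (show t * a < sSup (Set.range f) by rw [← ha]; nlinarith)
      exact ⟨x, (lt_div_iff₀ apos).2 hx⟩)
    (fun t ht => by
      obtain ⟨_, ⟨x, rfl⟩, hx⟩ := exists_lt_of_lt_csSup (Set.range_nonempty g)
        (show t * b < sSup (Set.range g) by rw [← hb]; nlinarith)
      exact ⟨x, (lt_div_iff₀ bpos).2 hx⟩)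
    (fun x y => by
      rw [Real.div_rpow (f0 x) apos.le, Real.div_rpow (g0 y) bpos.le, div_mul_div_comm]
      exact div_le_div_of_nonneg_right (hyp x y) cpos.le)
  have scale : ∀ (k : ℝ → ℝ) (d : ℝ), 0 < d → ∫⁻ x, ENNReal.ofReal (k x) =
      ENNReal.ofReal d * ∫⁻ x, ENNReal.ofReal (k x / d) := by
    intro k d hd
    rw [← lintegral_const_mul' _ _ (by simp)]
    congr 1; ext x
    rw [← ENNReal.ofReal_mul hd.le, mul_div_cancel₀ _ hd.ne']
  rw [scale f a apos, scale g b bpos, scale h c cpos, ENNReal.mul_rpow_of_nonneg _ _ hl1.le,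
    ENNReal.mul_rpow_of_nonneg _ _ h0.le, mul_mul_mul_comm,
    ENNReal.ofReal_rpow_of_pos apos, ENNReal.ofReal_rpow_of_pos bpos,
    ← ENNReal.ofReal_mul (by positivity)]
  gcongr
  exact (ennreal_amgm h0 h1 _ _).trans key

lemma bm_pi {l : ℝ} (h0 : 0 < l) (h1 : l < 1) (n : ℕ) : ∀ {A B C : Set (Fin n → ℝ)},
    MeasurableSet A → MeasurableSet B → MeasurableSet C →
    Bornology.IsBounded A → Bornology.IsBounded B → Bornology.IsBounded C →
    (∀ x ∈ A, ∀ y ∈ B, (1 - l) • x + l • y ∈ C) →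
    volume A ^ (1 - l) * volume B ^ l ≤ volume C := by
  have hl1 : 0 < 1 - l := by linarith
  induction n with
  | zero =>
    intro A B C _ _ _ _ _ _ h
    rcases A.eq_empty_or_nonempty with rfl | ⟨x, hx⟩
    · simp [ENNReal.zero_rpow_of_pos hl1]
    rcases B.eq_empty_or_nonempty with rfl | ⟨y, hy⟩
    · simp [ENNReal.zero_rpow_of_pos h0]
    have e1 : A = Set.univ := by ext z; simp [Subsingleton.elim z x, hx]
    have e2 : B = Set.univ := by ext z; simp [Subsingleton.elim z y, hy]
    have e3 : C = Set.univ := by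
      ext z
      have := h x hx y hy
      rw [Subsingleton.elim z ((1 - l) • x + l • y)]
      exact ⟨fun _ => trivial, fun _ => this⟩
    rw [e1, e2, e3]
    simp [volume_pi]
  | succ n ih =>
    intro A B C hA hB hC bA bB bC h
    have mp := (volume_preserving_piFinSuccAbove (fun _ : Fin (n + 1) => ℝ) 0).symm
    let sl : Set (Fin (n + 1) → ℝ) → ℝ → Set (Fin n → ℝ) := fun S s => {z | Fin.cons s z ∈ S}
    have hcons : ∀ s : ℝ, Measurable (fun z : Fin n → ℝ => (Fin.cons s z : Fin (n + 1) → ℝ)) := by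
      intro s
      refine measurable_pi_iff.2 (Fin.cases ?_ ?_)
      · simp
      · intro i; simpa using measurable_pi_apply i
    have msl : ∀ S, MeasurableSet S → ∀ s, MeasurableSet (sl S s) := fun S hS s => hcons s hS
    have bd : ∀ S, Bornology.IsBounded S → ∃ R, ∀ s, sl S s ⊆ Metric.closedBall 0 R := by
      intro S hS
      obtain ⟨R, hR⟩ := hS.subset_closedBall 0
      refine ⟨R, fun s z hz => ?_⟩
      have := hR hz
      rw [mem_closedBall_zero_iff] at this ⊢
      have hR0 : 0 ≤ R := (norm_nonneg _).trans this
      rw [pi_norm_le_iff_of_nonneg hR0] at this ⊢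
      intro i
      simpa using this i.succ
    have bsl : ∀ S, Bornology.IsBounded S → ∀ s, Bornology.IsBounded (sl S s) := by
      intro S hS s
      obtain ⟨R, hR⟩ := bd S hS
      exact Metric.isBounded_closedBall.subset (hR s)
    have fub : ∀ S, MeasurableSet S → Bornology.IsBounded S →
        Measurable (fun s => (volume (sl S s)).toReal) ∧
        BddAbove (Set.range (fun s => (volume (sl S s)).toReal)) ∧
        volume S = ∫⁻ s, ENNReal.ofReal (volume (sl S s)).toReal := by
      intro S hS hb
      have hpre := mp.measure_preimage hS.nullMeasurableSet
      have hm := mp.measurable hS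
      have hsl : ∀ s, Prod.mk s ⁻¹' ((MeasurableEquiv.piFinSuccAbove (fun _ : Fin (n + 1) => ℝ) 0).symm ⁻¹' S) = sl S s := by
        intro s; ext z
        show (Fin.insertNth 0 s z : Fin (n + 1) → ℝ) ∈ S ↔ Fin.cons s z ∈ S
        rw [Fin.insertNth_zero']
      refine ⟨?_, ?_, ?_⟩
      · simp only [← hsl]
        exact (measurable_measure_prodMk_left hm).ennreal_toReal
      · obtain ⟨R, hR⟩ := bd S hb
        refine ⟨(volume (Metric.closedBall (0 : Fin n → ℝ) R)).toReal, ?_⟩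
        rintro _ ⟨s, rfl⟩
        exact ENNReal.toReal_mono (measure_closedBall_lt_top).ne (measure_mono (hR s))
      · rw [← hpre]
        erw [Measure.prod_apply hm]
        refine lintegral_congr fun s => ?_
        rw [ENNReal.ofReal_toReal]
        · rw [← hsl]
        · exact (bsl S hb s).measure_lt_top.ne
    obtain ⟨mA, dA, iA⟩ := fub A hA bA
    obtain ⟨mB, dB, iB⟩ := fub B hB bB
    obtain ⟨mC, dC, iC⟩ := fub C hC bC
    rw [iA, iB, iC]
    refine pl1 h0 h1 mA mB mC (fun _ => ENNReal.toReal_nonneg) (fun _ => ENNReal.toReal_nonneg)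
      (fun _ => ENNReal.toReal_nonneg) dA dB ?_
    intro s t
    have := ih (msl A hA s) (msl B hB t) (msl C hC ((1 - l) * s + l * t)) (bsl A bA s)
      (bsl B bB t) (bsl C bC _) (by
        intro x hx y hy
        have := h _ hx _ hy
        show Fin.cons _ _ ∈ C
        convert this using 1
        ext i
        refine Fin.cases ?_ ?_ i <;> simp)
    have := ENNReal.toReal_mono (bsl C bC _).measure_lt_top.ne this
    rwa [ENNReal.toReal_mul, ← ENNReal.toReal_rpow, ← ENNReal.toReal_rpow] at this

lemma bm_euclid {n : ℕ} {l : ℝ} (h0 : 0 < l) (h1 : l < 1) {A B C : Set (EuclideanSpace ℝ (Fin n))}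
    (hA : IsCompact A) (hB : IsCompact B) (hC : IsCompact C)
    (h : ∀ x ∈ A, ∀ y ∈ B, (1 - l) • x + l • y ∈ C) :
    volume A ^ (1 - l) * volume B ^ l ≤ volume C := by
  have mp := PiLp.volume_preserving_toLp (Fin n)
  have hc : Continuous (WithLp.ofLp : EuclideanSpace ℝ (Fin n) → _) :=
    PiLp.continuous_ofLp 2 (fun _ : Fin n => ℝ)
  have key : ∀ S : Set (EuclideanSpace ℝ (Fin n)), IsCompact S →
      IsCompact (WithLp.toLp 2 ⁻¹' S : Set (Fin n → ℝ)) := by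
    intro S hS
    have : (WithLp.toLp 2 ⁻¹' S : Set (Fin n → ℝ)) = WithLp.ofLp '' S := by
      ext x
      constructor
      · intro hx; exact ⟨_, hx, rfl⟩
      · rintro ⟨y, hy, rfl⟩; exact hy
    rw [this]
    exact hS.image hc
  rw [← mp.measure_preimage hA.measurableSet.nullMeasurableSet,
    ← mp.measure_preimage hB.measurableSet.nullMeasurableSet,
    ← mp.measure_preimage hC.measurableSet.nullMeasurableSet]
  exact bm_pi h0 h1 n (key A hA).measurableSet (key B hB).measurableSet (key C hC).measurableSet
    (key A hA).isBounded (key B hB).isBounded (key C hC).isBounded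
    (fun x hx y hy => h _ hx _ hy)

section
variable {n : ℕ}

lemma supp_bdd {K : Set (EuclideanSpace ℝ (Fin n))} (hK : IsCompact K)
    (u : EuclideanSpace ℝ (Fin n)) : BddAbove ((fun x => ⟪x, u⟫) '' K) :=
  (hK.image (by fun_prop)).bddAbove

lemma le_supp {K : Set (EuclideanSpace ℝ (Fin n))} (hK : IsCompact K)
    (u : EuclideanSpace ℝ (Fin n)) {x} (hx : x ∈ K) : ⟪x, u⟫ ≤ supp K u :=
  le_csSup (supp_bdd hK u) ⟨x, hx, rfl⟩

lemma supp_attained {K : Set (EuclideanSpace ℝ (Fin n))} (hK : IsCompact K) (hn : K.Nonempty)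
    (u : EuclideanSpace ℝ (Fin n)) : ∃ x ∈ K, ⟪x, u⟫ = supp K u :=
  (hK.image (f := fun x => ⟪x, u⟫) (by fun_prop)).sSup_mem (hn.image _)

lemma supp_smul {c : ℝ} (hc : 0 ≤ c) (K : Set (EuclideanSpace ℝ (Fin n)))
    (u : EuclideanSpace ℝ (Fin n)) : supp (c • K) u = c * supp K u := by
  unfold supp
  rw [← smul_eq_mul, ← Real.sSup_smul_of_nonneg hc]
  congr 1
  ext r
  simp only [Set.mem_image, Set.mem_smul_set]
  constructor
  · rintro ⟨_, ⟨y, hy, rfl⟩, rfl⟩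
    exact ⟨_, ⟨y, hy, rfl⟩, by simp [real_inner_smul_left]⟩
  · rintro ⟨_, ⟨y, hy, rfl⟩, rfl⟩
    exact ⟨_, ⟨y, hy, rfl⟩, by simp [real_inner_smul_left]⟩

lemma supp_pos {K : Set (EuclideanSpace ℝ (Fin n))} (hK : IsConvexBodyO K)
    {u : EuclideanSpace ℝ (Fin n)} (hu : ‖u‖ = 1) : 0 < supp K u := by
  obtain ⟨h1, _, h0⟩ := hK
  obtain ⟨e, he, hb⟩ := Metric.mem_nhds_iff.1 (mem_interior_iff_mem_nhds.1 h0)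
  have hx : (e / 2) • u ∈ K := by
    apply hb
    rw [mem_ball_zero_iff, norm_smul, hu, Real.norm_of_nonneg (by linarith)]
    linarith
  have := le_supp h1 u hx
  rw [real_inner_smul_left, real_inner_self_eq_norm_sq, hu] at this
  linarith

lemma mem_of_supp {K : Set (EuclideanSpace ℝ (Fin n))} (hK : IsCompact K) (hc : Convex ℝ K)
    (hne : K.Nonempty) {x : EuclideanSpace ℝ (Fin n)}
    (h : ∀ u : EuclideanSpace ℝ (Fin n), ‖u‖ = 1 → ⟪x, u⟫ ≤ supp K u) : x ∈ K := by
  by_contra hx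
  obtain ⟨f, s, hs, hsx⟩ := geometric_hahn_banach_closed_point hc hK.isClosed hx
  set v := (InnerProductSpace.toDual ℝ _).symm f with hv
  have hf : ∀ y, f y = ⟪y, v⟫ := by
    intro y
    rw [real_inner_comm, hv, InnerProductSpace.toDual_symm_apply]
  have hv0 : v ≠ 0 := by
    intro h0
    obtain ⟨y, hy⟩ := hne
    have := hs y hy
    have hy0 : f y = 0 := by rw [hf, h0, inner_zero_right]
    have hx0 : f x = 0 := by rw [hf, h0, inner_zero_right]
    linarith
  have hvn : 0 < ‖v‖ := norm_pos_iff.2 hv0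
  have := h (‖v‖⁻¹ • v) (by rw [norm_smul, norm_inv, norm_norm, inv_mul_cancel₀ hvn.ne'])
  obtain ⟨y, hy, hyu⟩ := supp_attained hK hne (‖v‖⁻¹ • v)
  rw [← hyu, real_inner_smul_right, real_inner_smul_right, ← hf, ← hf] at this
  have := le_of_mul_le_mul_left this (inv_pos.2 hvn)
  linarith [hs y hy]

lemma subset_of_supp {K L : Set (EuclideanSpace ℝ (Fin n))} (hK : IsConvexBodyO K)
    (hL : IsConvexBodyO L)
    (h : ∀ u : EuclideanSpace ℝ (Fin n), ‖u‖ = 1 → supp K u ≤ supp L u) : K ⊆ L := by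
  intro x hx
  exact mem_of_supp hL.1 hL.2.1 ⟨0, interior_subset hL.2.2⟩
    fun u hu => (le_supp hK.1 u hx).trans (h u hu)

lemma IsConvexBodyO.smul' {K : Set (EuclideanSpace ℝ (Fin n))} (hK : IsConvexBodyO K) {c : ℝ}
    (hc : 0 < c) : IsConvexBodyO (c • K) := by
  refine ⟨hK.1.smul c, hK.2.1.smul c, ?_⟩
  rw [interior_smul₀ hc.ne']
  exact ⟨0, hK.2.2, by simp⟩

lemma IsConvexBodyO.vol_pos {K : Set (EuclideanSpace ℝ (Fin n))} (hK : IsConvexBodyO K) :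
    0 < (volume K).toReal :=
  ENNReal.toReal_pos (Measure.measure_pos_of_nonempty_interior _ ⟨0, hK.2.2⟩).ne'
    hK.1.measure_lt_top.ne

lemma vol_smul (K : Set (EuclideanSpace ℝ (Fin n))) {c : ℝ} (hc : 0 < c) :
    (volume (c • K)).toReal = c ^ n * (volume K).toReal := by
  rw [Measure.addHaar_smul, ENNReal.toReal_mul, finrank_euclideanSpace_fin,
    abs_of_pos (by positivity), ENNReal.toReal_ofReal (by positivity)]

lemma firey_norm {p : ℝ} (hp : 1 < p) {K L M : Set (EuclideanSpace ℝ (Fin n))}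
    (hK : IsConvexBodyO K) (hL : IsConvexBodyO L) (hM : IsConvexBodyO M)
    {l : ℝ} (h0 : 0 < l) (h1 : l < 1)
    (hs : ∀ u : EuclideanSpace ℝ (Fin n), ‖u‖ = 1 →
      supp M u ^ p = (1 - l) * supp K u ^ p + l * supp L u ^ p)
    (vK : (volume K).toReal = 1) (vL : (volume L).toReal = 1) :
    1 ≤ (volume M).toReal ∧ ((volume M).toReal = 1 → K = L) := by
  have vK' : volume K = 1 := by
    rwa [ENNReal.toReal_eq_one_iff] at vK
  have vL' : volume L = 1 := by
    rwa [ENNReal.toReal_eq_one_iff] at vL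
  set D := (1 - l) • K + l • L with hD
  have cD : IsCompact D := (hK.1.smul _).add (hL.1.smul _)
  have hl1 : 0 < 1 - l := by linarith
  have hDM : D ⊆ M := by
    rintro _ ⟨_, ⟨x, hx, rfl⟩, _, ⟨y, hy, rfl⟩, rfl⟩
    refine mem_of_supp hM.1 hM.2.1 ⟨0, interior_subset hM.2.2⟩ fun u hu => ?_
    have k0 := supp_pos hK hu
    have l0 := supp_pos hL hu
    have m0 := supp_pos hM hu
    have h2 : (1 - l) * supp K u + l * supp L u ≤ supp M u := by
      have := (convexOn_rpow hp.le).2 (Set.mem_Ici.2 k0.le) (Set.mem_Ici.2 l0.le) hl1.le h0.le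
        (by ring)
      simp only [smul_eq_mul] at this
      rw [← hs u hu] at this
      exact (Real.rpow_le_rpow_iff (by positivity) m0.le (by linarith)).1 this
    simp only [inner_add_left, real_inner_smul_left]
    have := le_supp hK.1 u hx
    have := le_supp hL.1 u hy
    nlinarith
  have vD : 1 ≤ volume D := by
    have := bm_euclid h0 h1 hK.1 hL.1 cD (fun x hx y hy =>
      Set.add_mem_add (Set.smul_mem_smul_set hx) (Set.smul_mem_smul_set hy))
    simpa [vK', vL'] using this
  have fM : volume M ≠ ⊤ := hM.1.measure_lt_top.ne
  refine ⟨?_, ?_⟩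
  · have := ENNReal.toReal_mono fM (vD.trans (measure_mono hDM))
    simpa using this
  · intro vM
    rw [ENNReal.toReal_eq_one_iff] at vM
    have hMD : M ⊆ D := by
      by_contra hcon
      obtain ⟨x, hxM, hxD⟩ := Set.not_subset.1 hcon
      have hxc : x ∈ closure (interior M) := by
        rw [hM.2.1.closure_interior_eq_closure_of_nonempty_interior ⟨0, hM.2.2⟩]
        exact subset_closure hxM
      have ho : IsOpen (Dᶜ) := cD.isClosed.isOpen_compl
      have hne : (Dᶜ ∩ interior M).Nonempty := mem_closure_iff.1 hxc _ ho hxD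
      have hpos : 0 < volume (Dᶜ ∩ interior M) := (ho.inter isOpen_interior).measure_pos _ hne
      have hle : volume (Dᶜ ∩ interior M) ≤ volume (M \ D) :=
        measure_mono fun z hz => ⟨interior_subset hz.2, hz.1⟩
      rw [measure_sdiff hDM cD.measurableSet.nullMeasurableSet cD.measure_lt_top.ne, vM,
        tsub_eq_zero_of_le vD] at hle
      exact absurd hle (not_le.2 hpos)
    have heq : ∀ u : EuclideanSpace ℝ (Fin n), ‖u‖ = 1 → supp K u = supp L u := by
      intro u hu
      have k0 := supp_pos hK hu
      have l0 := supp_pos hL hu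
      have m0 := supp_pos hM hu
      by_contra hne
      have := (strictConvexOn_rpow hp).2 (Set.mem_Ici.2 k0.le) (Set.mem_Ici.2 l0.le) hne hl1 h0
        (by ring)
      simp only [smul_eq_mul] at this
      rw [← hs u hu] at this
      have h3 := (Real.rpow_lt_rpow_iff (by positivity) m0.le (by linarith)).1 this
      obtain ⟨z, hz, hzu⟩ := supp_attained hM.1 ⟨0, interior_subset hM.2.2⟩ u
      obtain ⟨_, ⟨x, hx, rfl⟩, _, ⟨y, hy, rfl⟩, rfl⟩ := hMD hz
      simp only [inner_add_left, real_inner_smul_left] at hzu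
      have := le_supp hK.1 u hx
      have := le_supp hL.1 u hy
      nlinarith
    exact (subset_of_supp hK hL fun u hu => (heq u hu).le).antisymm
      (subset_of_supp hL hK fun u hu => (heq u hu).ge)

end

/-- Firey's `L_p` Brunn–Minkowski inequality for volume. For
`1 < p < ∞`, `K, L ∈ 𝒦ⁿₒ`, `α ∈ (0,1)`, and `M = (1-α)·_p K +_p α·_p L` (the convex
body with origin in its interior whose support function satisfies
`h_M^p = (1-α) h_K^p + α h_L^p` on the unit sphere),
`V_n(M)^{p/n} ≥ (1-α)V_n(K)^{p/n} + αV_n(L)^{p/n}`, with equality if and only if `K`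
and `L` are dilates. -/
theorem firey_lp_brunn_minkowski {n : ℕ} (hn : 1 ≤ n) (p : ℝ) (hp : 1 < p)
    (K L M : Set (EuclideanSpace ℝ (Fin n)))
    (hK : IsConvexBodyO K) (hL : IsConvexBodyO L) (hM : IsConvexBodyO M)
    (α : ℝ) (hα : α ∈ Set.Ioo (0:ℝ) 1)
    (hMsupp : ∀ u : EuclideanSpace ℝ (Fin n), ‖u‖ = 1 →
      supp M u ^ p = (1 - α) * supp K u ^ p + α * supp L u ^ p) :
    (1 - α) * (volume K).toReal ^ (p / n) + α * (volume L).toReal ^ (p / n) ≤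
        (volume M).toReal ^ (p / n) ∧
      ((volume M).toReal ^ (p / n) =
          (1 - α) * (volume K).toReal ^ (p / n) + α * (volume L).toReal ^ (p / n) ↔
        ∃ c : ℝ, 0 < c ∧ K = c • L) := by
  obtain ⟨hα0, hα1⟩ := hα
  have hα1' : 0 < 1 - α := by linarith
  have hp0 : 0 < p := by linarith
  have hn0 : (0 : ℝ) < n := by exact_mod_cast hn
  have hnn : n ≠ 0 := by omega
  -- radii
  have rad : ∀ S : Set (EuclideanSpace ℝ (Fin n)), IsConvexBodyO S →
      ∃ a : ℝ, 0 < a ∧ (volume S).toReal = a ^ n := by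
    intro S hS
    refine ⟨(volume S).toReal ^ ((n : ℝ)⁻¹), Real.rpow_pos_of_pos hS.vol_pos _, ?_⟩
    rw [Real.rpow_inv_natCast_pow hS.vol_pos.le hnn]
  have powe : ∀ a : ℝ, 0 < a → (a ^ n) ^ (p / n) = a ^ p := by
    intro a ha
    rw [← Real.rpow_natCast, ← Real.rpow_mul ha.le, mul_div_cancel₀ _ hn0.ne']
  obtain ⟨a, ha, vK⟩ := rad K hK
  obtain ⟨b, hb, vL⟩ := rad L hL
  obtain ⟨d, hd, vM⟩ := rad M hM
  rw [vK, vL, vM, powe a ha, powe b hb, powe d hd]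
  set S := (1 - α) * a ^ p + α * b ^ p with hS
  have Spos : 0 < S := by positivity
  set m := S ^ p⁻¹ with hm
  have mpos : 0 < m := by positivity
  have mp : m ^ p = S := Real.rpow_inv_rpow Spos.le hp0.ne'
  set l := α * b ^ p / S with hl
  have l0 : 0 < l := by positivity
  have l1' : 1 - l = (1 - α) * a ^ p / S := by
    rw [hl, eq_div_iff Spos.ne', sub_mul, div_mul_cancel₀ _ Spos.ne', hS]; ring
  have l1 : l < 1 := by
    have : 0 < 1 - l := by rw [l1']; positivity
    linarith
  have key := firey_norm hp (hK.smul' (inv_pos.2 ha)) (hL.smul' (inv_pos.2 hb))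
    (hM.smul' (inv_pos.2 mpos)) l0 l1 (by
      intro u hu
      have k0 := supp_pos hK hu
      have l0 := supp_pos hL hu
      have m0 := supp_pos hM hu
      rw [supp_smul (by positivity), supp_smul (by positivity), supp_smul (by positivity),
        Real.mul_rpow (by positivity) (by positivity), Real.mul_rpow (by positivity) (by positivity),
        Real.mul_rpow (by positivity) (by positivity), Real.inv_rpow mpos.le, Real.inv_rpow ha.le,
        Real.inv_rpow hb.le, mp, hMsupp u hu, l1', hl]
      have : 0 < a ^ p := by positivity
      have : 0 < b ^ p := by positivity
      field_simp)
    (by rw [vol_smul _ (inv_pos.2 ha), vK, ← mul_pow, inv_mul_cancel₀ ha.ne', one_pow])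
    (by rw [vol_smul _ (inv_pos.2 hb), vL, ← mul_pow, inv_mul_cancel₀ hb.ne', one_pow])
  rw [vol_smul _ (inv_pos.2 mpos), vM, ← mul_pow] at key
  obtain ⟨key1, key2⟩ := key
  refine ⟨?_, ?_, ?_⟩
  · rw [one_le_pow_iff_of_nonneg (by positivity) hnn, ← div_eq_inv_mul, one_le_div mpos] at key1
    rw [← mp]
    exact Real.rpow_le_rpow mpos.le key1 hp0.le
  · intro h
    have hdm : d = m := by
      rw [hm, ← h, Real.rpow_rpow_inv hd.le hp0.ne']
    have := key2 (by rw [hdm, inv_mul_cancel₀ mpos.ne', one_pow])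
    refine ⟨a * b⁻¹, by positivity, ?_⟩
    rw [mul_smul, ← this, smul_inv_smul₀ ha.ne']
  · rintro ⟨c, hc, hKL⟩
    set e := ((1 - α) * c ^ p + α) ^ p⁻¹ with he
    have hT : 0 < (1 - α) * c ^ p + α := by positivity
    have epos : 0 < e := by positivity
    have ep : e ^ p = (1 - α) * c ^ p + α := Real.rpow_inv_rpow hT.le hp0.ne'
    have heq : ∀ u : EuclideanSpace ℝ (Fin n), ‖u‖ = 1 → supp M u = supp (e • L) u := by
      intro u hu
      have l0 := supp_pos hL hu
      have m0 := supp_pos hM hu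
      rw [supp_smul epos.le]
      have := hMsupp u hu
      rw [hKL, supp_smul hc.le, Real.mul_rpow hc.le l0.le] at this
      have h2 : supp M u ^ p = (e * supp L u) ^ p := by
        rw [this, Real.mul_rpow epos.le l0.le, ep]; ring
      exact (Real.rpow_left_inj m0.le (by positivity) hp0.ne').1 h2
    have hML : M = e • L := (subset_of_supp hM (hL.smul' epos) fun u hu => (heq u hu).le).antisymm
      (subset_of_supp (hL.smul' epos) hM fun u hu => (heq u hu).ge)
    have hac : a = c * b := by
      rw [hKL, vol_smul _ hc, vL, ← mul_pow] at vK
      exact ((pow_left_inj₀ (by positivity) ha.le hnn).1 vK).symm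
    have hde : d = e * b := by
      rw [hML, vol_smul _ epos, vL, ← mul_pow] at vM
      exact ((pow_left_inj₀ (by positivity) hd.le hnn).1 vM).symm
    rw [hS, hac, hde, Real.mul_rpow epos.le hb.le, Real.mul_rpow hc.le hb.le, ep]
    ring
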